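/- With the briber's preference order a >_σ b >_σ c, distinguished candidate d = c, and the destructive goal that c not be a Veto winner of the final profile: letting m = min(k, |R|), the briber has a winning strategy from the position (P, R, k) if and only if there exists a set H ⊆ R with |H| = m such that every voter in H has weight at least the weight of every voter in R ∖ H, and for every assignment g : R ∖ H → {a, b}, candidate c is not a Veto winner of the final profile in which every voter of H vetoes c and every voter v ∈ R ∖ H vetoes g(v) (each with its own weight). -/

import Mathlib

/-- The Veto score of `x` in a profile of weighted Veto ballots (each ballot names
the candidate it vetoes): the sum of the weights of the ballots not vetoing `x`. -/
def vetoScore {C : Type} [DecidableEq C] (P : List (C × ℕ)) (x : C) : ℕ :=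
  (P.map (fun e => if e.1 = x then 0 else e.2)).sum

/-- `x` is a Veto winner of profile `P`: its Veto score is maximal. -/
def vetoWinner {C : Type} [DecidableEq C] (P : List (C × ℕ)) (x : C) : Prop :=
  ∀ y : C, vetoScore P y ≤ vetoScore P x

/-- `x` is the unique Veto winner of profile `P`: it is a winner and every winner
equals `x`. -/
def vetoUniqueWinner {C : Type} [DecidableEq C] (P : List (C × ℕ)) (x : C) : Prop :=
  vetoWinner P x ∧ ∀ y : C, vetoWinner P y → y = x

/-- Online weighted bribery game with bribe limit (pre-reveal position): the briber
can guarantee `goal` from the position in which the profile `P` has already been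
cast, the remaining voters have weights listed in `R` (ballots not yet revealed),
and at most `k` bribes may still be used.  At each reveal the briber either keeps
the revealed ballot or, provided a bribe is still available, replaces it by an
arbitrary ballot. -/
def winsLimVeto {C : Type} [DecidableEq C] (goal : List (C × ℕ) → Prop) :
    List (C × ℕ) → List ℕ → ℕ → Prop
  | P, [], _ => goal P
  | P, w :: R, k =>
      ∀ v : C, winsLimVeto goal ((v, w) :: P) R k ∨
        (1 ≤ k ∧ ∃ v' : C, winsLimVeto goal ((v', w) :: P) R (k - 1))

/-- Total weight of ballots vetoing `x`. -/
def vW {C : Type} [DecidableEq C] (P : List (C × ℕ)) (x : C) : ℕ :=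
  (P.map (fun e => if e.1 = x then e.2 else 0)).sum

theorem vetoScore_add_vW {C : Type} [DecidableEq C] (P : List (C × ℕ)) (x : C) :
    vetoScore P x + vW P x = (P.map Prod.snd).sum := by
  induction P with
  | nil => rfl
  | cons e P ih =>
    simp only [vetoScore, vW, List.map_cons, List.sum_cons] at *
    split_ifs <;> omega

theorem vetoWinner_iff {C : Type} [DecidableEq C] (P : List (C × ℕ)) (x : C) :
    vetoWinner P x ↔ ∀ y, vW P x ≤ vW P y := by
  unfold vetoWinner
  refine forall_congr' fun y => ?_
  have h1 := vetoScore_add_vW P x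
  have h2 := vetoScore_add_vW P y
  omega

theorem vW_cons {C : Type} [DecidableEq C] (v : C) (w : ℕ) (P : List (C × ℕ)) (x : C) :
    vW ((v, w) :: P) x = vW P x + if v = x then w else 0 := by
  simp [vW, add_comm]

theorem vW_append_ofFn {C : Type} [DecidableEq C] {n : ℕ} (P : List (C × ℕ))
    (f : Fin n → C × ℕ) (x : C) :
    vW (P ++ List.ofFn f) x = vW P x + ∑ i, if (f i).1 = x then (f i).2 else 0 := by
  simp [vW, List.map_ofFn, List.sum_ofFn]

/-- Adversary's invariant. -/
def BadPos (pa pb pc : ℕ) (R : Multiset ℕ) (k : ℕ) : Prop :=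
  ∃ H X Y : Multiset ℕ, R = H + X + Y ∧ (k ≤ H.card ∨ (X = 0 ∧ Y = 0)) ∧
    (∀ h ∈ H, ∀ x, (x ∈ X ∨ x ∈ Y) → x ≤ h) ∧
    pc + H.sum ≤ pa + X.sum ∧ pc + H.sum ≤ pb + Y.sum

theorem BadPos.mono {pa pb pc pa' pb' pc' : ℕ} {R : Multiset ℕ} {k : ℕ}
    (h : BadPos pa pb pc R k) (ha : pa ≤ pa') (hb : pb ≤ pb') (hc : pc' ≤ pc) :
    BadPos pa' pb' pc' R k := by
  obtain ⟨H, X, Y, h1, h2, h3, h4, h5⟩ := h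
  exact ⟨H, X, Y, h1, h2, h3, by omega, by omega⟩

theorem BadPos.swap {pa pb pc : ℕ} {R : Multiset ℕ} {k : ℕ}
    (h : BadPos pa pb pc R k) : BadPos pb pa pc R k := by
  obtain ⟨H, X, Y, h1, h2, h3, h4, h5⟩ := h
  exact ⟨H, Y, X, by rw [h1]; abel, by tauto, fun h hh x hx => h3 h hh x hx.symm, h5, h4⟩

theorem exists_min_mem (H : Multiset ℕ) (h : H ≠ 0) : ∃ m ∈ H, ∀ x ∈ H, m ≤ x := by
  obtain ⟨m, hm, hmin⟩ := H.toFinset.exists_min_image id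
    (by rwa [Multiset.toFinset_nonempty])
  exact ⟨m, by simpa using hm, fun x hx => hmin x (by simpa using hx)⟩

theorem exists_max_mem (H : Multiset ℕ) (h : H ≠ 0) : ∃ m ∈ H, ∀ x ∈ H, x ≤ m := by
  obtain ⟨m, hm, hmin⟩ := H.toFinset.exists_max_image id
    (by rwa [Multiset.toFinset_nonempty])
  exact ⟨m, by simpa using hm, fun x hx => hmin x (by simpa using hx)⟩

theorem bad_step_X {pa pb pc u k : ℕ} {R H X Y : Multiset ℕ}
    (h1 : u ::ₘ R = H + (u ::ₘ X) + Y) (h2 : k ≤ H.card)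
    (h3 : ∀ h ∈ H, ∀ x, (x ∈ u ::ₘ X ∨ x ∈ Y) → x ≤ h)
    (h4 : pc + H.sum ≤ pa + (u ::ₘ X).sum) (h5 : pc + H.sum ≤ pb + Y.sum) :
    BadPos (pa + u) pb pc R k ∧ (1 ≤ k → BadPos pa pb (pc + u) R (k - 1)) := by
  have hR : R = H + X + Y := by
    rw [← Multiset.cons_inj_right u, h1]
    simp [← Multiset.singleton_add]; abel
  rw [Multiset.sum_cons] at h4
  refine ⟨⟨H, X, Y, hR, Or.inl h2, ?_, by omega, h5⟩, fun hk => ?_⟩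
  · intro h hh x hx
    exact h3 h hh x (by rcases hx with hx | hx <;> simp [hx])
  · have hH : H ≠ 0 := by
      rintro rfl
      simp at h2; omega
    obtain ⟨m, hm, hmin⟩ := exists_min_mem H hH
    obtain ⟨H', rfl⟩ := Multiset.exists_cons_of_mem hm
    have hum : u ≤ m := h3 m hm u (by simp)
    rw [Multiset.sum_cons] at h4 h5
    rw [Multiset.card_cons] at h2
    refine ⟨H', m ::ₘ X, Y, ?_, Or.inl (by omega), ?_, ?_, by omega⟩
    · rw [hR]; simp only [← Multiset.singleton_add]; abel
    · intro h hh x hx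
      rcases hx with hx | hx
      · rcases Multiset.mem_cons.1 hx with rfl | hx
        · exact hmin h (by simp [hh])
        · exact h3 h (by simp [hh]) x (by simp [hx])
      · exact h3 h (by simp [hh]) x (by simp [hx])
    · rw [Multiset.sum_cons]; omega

theorem bad_step_H {pa pb pc u k v : ℕ} {R H X Y : Multiset ℕ}
    (hR : R = H + (v ::ₘ X) + Y) (h2 : k ≤ (u ::ₘ H).card)
    (h3 : ∀ h ∈ u ::ₘ H, ∀ x, (x ∈ v ::ₘ X ∨ x ∈ Y) → x ≤ h)
    (h4 : pc + (u ::ₘ H).sum ≤ pa + (v ::ₘ X).sum) (h5 : pc + (u ::ₘ H).sum ≤ pb + Y.sum)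
    (hmax : ∀ x, (x ∈ v ::ₘ X ∨ x ∈ Y) → x ≤ v) :
    BadPos (pa + u) pb pc R k := by
  have hvu : v ≤ u := h3 u (by simp) v (by simp)
  rw [Multiset.sum_cons] at h5
  rw [Multiset.sum_cons, Multiset.sum_cons] at h4
  refine ⟨v ::ₘ H, X, Y, ?_, Or.inl (by simpa using h2), ?_, ?_, ?_⟩
  · rw [hR]; simp only [← Multiset.singleton_add]; abel
  · intro h hh x hx
    have hx' : x ∈ v ::ₘ X ∨ x ∈ Y := by rcases hx with hx | hx <;> simp [hx]
    rcases Multiset.mem_cons.1 hh with rfl | hh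
    · exact hmax x hx'
    · exact h3 h (by simp [hh]) x hx'
  · rw [Multiset.sum_cons]; omega
  · rw [Multiset.sum_cons]; omega

theorem BadPos.step {pa pb pc u k : ℕ} {R : Multiset ℕ}
    (h : BadPos pa pb pc (u ::ₘ R) k) :
    (BadPos (pa + u) pb pc R k ∨ BadPos pa (pb + u) pc R k) ∧
      (1 ≤ k → BadPos pa pb (pc + u) R (k - 1)) := by
  obtain ⟨H, X, Y, h1, h2, h3, h4, h5⟩ := h
  have hu : u ∈ H + X + Y := by rw [← h1]; simp
  rw [Multiset.mem_add, Multiset.mem_add] at hu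
  rcases hu with (hu | hu) | hu
  · obtain ⟨H, rfl⟩ := Multiset.exists_cons_of_mem hu
    have hR : R = H + X + Y := by
      rw [← Multiset.cons_inj_right u, h1]
      simp
    constructor
    · by_cases h0 : X + Y = 0
      · left
        obtain ⟨rfl, rfl⟩ : X = 0 ∧ Y = 0 := by simpa using h0
        rw [Multiset.sum_cons] at h4 h5
        exact ⟨H, 0, 0, hR, Or.inr ⟨rfl, rfl⟩, by simp, by omega, by omega⟩
      · obtain ⟨v, hv, hmax⟩ := exists_max_mem _ h0
        have h2' : k ≤ (u ::ₘ H).card := by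
          rcases h2 with h2 | ⟨rfl, rfl⟩
          · exact h2
          · simp at h0
        have hmax' : ∀ x, (x ∈ X ∨ x ∈ Y) → x ≤ v := fun x hx => hmax x (by simpa using hx)
        rcases Multiset.mem_add.1 hv with hv | hv
        · left
          obtain ⟨X, rfl⟩ := Multiset.exists_cons_of_mem hv
          exact bad_step_H hR h2' h3 h4 h5 hmax'
        · right
          obtain ⟨Y, rfl⟩ := Multiset.exists_cons_of_mem hv
          exact (bad_step_H (by rw [hR]; abel) h2' (fun h hh x hx => h3 h hh x hx.symm)
            h5 h4 (fun x hx => hmax' x hx.symm)).swap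
    · intro hk
      rw [Multiset.sum_cons] at h4 h5
      rw [Multiset.card_cons] at h2
      refine ⟨H, X, Y, hR, ?_, fun h hh => h3 h (by simp [hh]), by omega, by omega⟩
      rcases h2 with h2 | h2
      · left; omega
      · right; exact h2
  · obtain ⟨X, rfl⟩ := Multiset.exists_cons_of_mem hu
    have h2' : k ≤ H.card := by simpa using h2
    have := bad_step_X h1 h2' h3 h4 h5
    exact ⟨Or.inl this.1, this.2⟩
  · obtain ⟨Y, rfl⟩ := Multiset.exists_cons_of_mem hu
    have h2' : k ≤ H.card := by simpa using h2
    have := bad_step_X (by rw [h1]; abel) h2' (fun h hh x hx => h3 h hh x hx.symm) h5 h4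
    exact ⟨Or.inr this.1.swap, fun hk => (this.2 hk).swap⟩

theorem bad_not_wins {C : Type} [DecidableEq C] (a b c : C)
    (hab : a ≠ b) (hac : a ≠ c) (hbc : b ≠ c)
    (hall : ∀ x : C, x = a ∨ x = b ∨ x = c) (R : List ℕ) :
    ∀ (P : List (C × ℕ)) (k : ℕ), BadPos (vW P a) (vW P b) (vW P c) (R : Multiset ℕ) k →
      ¬ winsLimVeto (fun F => ¬ vetoWinner F c) P R k := by
  induction R with
  | nil =>
    intro P k ⟨H, X, Y, h1, h2, h3, h4, h5⟩
    simp only [winsLimVeto, not_not, vetoWinner_iff]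
    have h0 : H + X + Y = 0 := by rw [← h1]; simp
    simp only [add_eq_zero] at h0
    obtain ⟨⟨rfl, rfl⟩, rfl⟩ := h0
    simp at h4 h5
    intro y
    rcases hall y with rfl | rfl | rfl <;> simp [h4, h5]
  | cons u R ih =>
    intro P k hbad hw
    rw [← Multiset.cons_coe] at hbad
    obtain ⟨hkeep, hbr⟩ := hbad.step
    simp only [winsLimVeto] at hw
    have hno : ¬ (1 ≤ k ∧ ∃ v' : C, winsLimVeto (fun F => ¬ vetoWinner F c)
        ((v', u) :: P) R (k - 1)) := by
      rintro ⟨hk, v', hv⟩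
      refine ih _ _ ((hbr hk).mono ?_ ?_ ?_) hv
      · rw [vW_cons]; omega
      · rw [vW_cons]; omega
      · rw [vW_cons]; split_ifs <;> omega
    rcases hkeep with hkeep | hkeep
    · refine ih _ _ (hkeep.mono ?_ ?_ ?_) ((hw a).resolve_right hno) <;>
        simp [vW_cons, hac]
    · refine ih _ _ (hkeep.mono ?_ ?_ ?_) ((hw b).resolve_right hno) <;>
        simp [vW_cons, hbc]

theorem strat_wins {C : Type} [DecidableEq C] (c : C) (R : List ℕ) :
    ∀ (P : List (C × ℕ)) (k : ℕ) (h : Fin R.length → Bool),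
      (∑ i, if h i then 1 else 0) ≤ k →
      (∀ g : Fin R.length → C,
        ¬ vetoWinner (P ++ List.ofFn (fun i => (if h i then c else g i, R.get i))) c) →
      winsLimVeto (fun F => ¬ vetoWinner F c) P R k := by
  induction R with
  | nil =>
    intro P k h _ hg
    have := hg (fun _ => c)
    simpa [winsLimVeto] using this
  | cons w R ih =>
    intro P k h hk hg
    have hk' : (if h 0 then 1 else 0) + (∑ i : Fin R.length, if h i.succ then 1 else 0) ≤ k := by
      have := Fin.sum_univ_succ (n := R.length) (fun i => if h i then 1 else 0)
      exact this ▸ hk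
    have key : ∀ (v : C) (g : Fin R.length → C),
        ¬ vetoWinner (((if h 0 then c else v, w) :: P) ++
          List.ofFn (fun i => (if h i.succ then c else g i, R.get i))) c := by
      intro v g
      have := hg (Fin.cons v g : Fin (R.length + 1) → C)
      rw [vetoWinner_iff] at this ⊢
      have heq : ∀ y, vW (((if h 0 then c else v, w) :: P) ++
          List.ofFn (fun i => (if h i.succ then c else g i, R.get i))) y
          = vW (P ++ List.ofFn (fun i : Fin (R.length + 1) =>
            (if h i then c else (Fin.cons v g : Fin (R.length + 1) → C) i,
              (w :: R).get i))) y := by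
        intro y
        simp only [vW_append_ofFn, vW_cons, Fin.sum_univ_succ]
        simp [add_assoc]
      simp only [heq]
      exact this
    simp only [winsLimVeto]
    intro v
    by_cases h0 : h 0 = true
    · right
      simp only [h0, if_true] at hk' key
      exact ⟨by omega, c, ih _ _ (fun i => h i.succ) (by omega) (fun g => key v g)⟩
    · left
      simp only [h0] at hk' key
      exact ih _ _ (fun i => h i.succ) (by simpa using hk') (fun g => key v g)

theorem exists_top {n : ℕ} (f : Fin n → ℕ) (m : ℕ) (hm : m ≤ n) :
    ∃ H : Finset (Fin n), H.card = m ∧ ∀ i ∈ H, ∀ j, j ∉ H → f j ≤ f i := by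
  induction m with
  | zero => exact ⟨∅, by simp, by simp⟩
  | succ m ih =>
    obtain ⟨H, hc, hH⟩ := ih (by omega)
    have hne : (Hᶜ).Nonempty := by
      rw [← Finset.card_pos, Finset.card_compl, Fintype.card_fin]; omega
    obtain ⟨v, hv, hmax⟩ := Finset.exists_max_image _ f hne
    rw [Finset.mem_compl] at hv
    refine ⟨insert v H, by rw [Finset.card_insert_of_notMem hv, hc], ?_⟩
    intro i hi j hj
    rw [Finset.mem_insert, not_or] at hj
    rcases Finset.mem_insert.1 hi with rfl | hi
    · exact hmax j (by simpa using hj.2)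
    · exact hH i hi j hj.2

theorem veto3_online_weighted_limited_destructive_c
    {C : Type} [DecidableEq C] (a b c : C)
    (hab : a ≠ b) (hac : a ≠ c) (hbc : b ≠ c)
    (hall : ∀ x : C, x = a ∨ x = b ∨ x = c)
    (P : List (C × ℕ)) (R : List ℕ) (k : ℕ) :
    winsLimVeto (fun F => ¬ vetoWinner F c) P R k ↔
      ∃ H : Finset (Fin R.length),
        H.card = min k R.length ∧
        (∀ i ∈ H, ∀ j : Fin R.length, j ∉ H → R.get j ≤ R.get i) ∧
        ∀ g : Fin R.length → C, (∀ i : Fin R.length, i ∉ H → g i = a ∨ g i = b) →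
          ¬ vetoWinner
              (P ++ List.ofFn (fun i => (if i ∈ H then c else g i, R.get i))) c := by
  constructor
  · intro hw
    obtain ⟨H, hcard, htop⟩ := exists_top R.get (min k R.length) (min_le_right _ _)
    refine ⟨H, hcard, htop, fun g hg hwin => ?_⟩
    refine bad_not_wins a b c hab hac hbc hall R P k ?_ hw
    rw [vetoWinner_iff] at hwin
    have hwa := hwin a
    have hwb := hwin b
    simp only [vW_append_ofFn] at hwa hwb
    have ec : (∑ i, if (if i ∈ H then c else g i) = c then R.get i else 0)
        = ∑ i ∈ H, R.get i := by
      rw [← Finset.sum_filter]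
      refine Finset.sum_congr ?_ fun _ _ => rfl
      ext i
      by_cases hi : i ∈ H
      · simp [hi]
      · rcases hg i hi with h | h <;> simp [hi, h, hac, hbc]
    have ea : (∑ i, if (if i ∈ H then c else g i) = a then R.get i else 0)
        = ∑ i with i ∉ H ∧ g i = a, R.get i := by
      rw [← Finset.sum_filter]
      refine Finset.sum_congr ?_ fun _ _ => rfl
      ext i
      by_cases hi : i ∈ H
      · simp [hi, hac.symm]
      · simp [hi]
    have eb : (∑ i, if (if i ∈ H then c else g i) = b then R.get i else 0)
        = ∑ i with i ∉ H ∧ g i ≠ a, R.get i := by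
      rw [← Finset.sum_filter]
      refine Finset.sum_congr ?_ fun _ _ => rfl
      ext i
      by_cases hi : i ∈ H
      · simp [hi, hbc.symm]
      · rcases hg i hi with h | h <;> simp [hi, h, hab, hab.symm]
    rw [ec, ea] at hwa
    rw [ec, eb] at hwb
    refine ⟨H.val.map R.get, (Finset.univ.filter fun i => i ∉ H ∧ g i = a).val.map R.get,
      (Finset.univ.filter fun i => i ∉ H ∧ g i ≠ a).val.map R.get, ?_, ?_, ?_, hwa, hwb⟩
    · have e1 : (R : Multiset ℕ) = (Finset.univ : Finset (Fin R.length)).val.map R.get := by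
        rw [Fin.univ_val_map, List.ofFn_get]
      rw [e1, ← Multiset.map_add, ← Multiset.map_add]
      congr 1
      have e2 := Multiset.filter_add_not (fun i => i ∈ H)
        (Finset.univ : Finset (Fin R.length)).val
      have e3 := Multiset.filter_add_not (fun i => g i = a)
        (Multiset.filter (fun i => i ∉ H) (Finset.univ : Finset (Fin R.length)).val)
      rw [Multiset.filter_filter, Multiset.filter_filter] at e3
      have e4 : Multiset.filter (fun i => i ∈ H) (Finset.univ : Finset (Fin R.length)).val
          = H.val := by
        rw [← Finset.filter_val]; simp
      rw [e4, ← e3, ← add_assoc] at e2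
      rw [← e2]
      simp only [Finset.filter_val, and_comm, ne_eq]
    · rw [Multiset.card_map, Finset.card_val, hcard]
      by_cases hk : k ≤ R.length
      · left; simp [hk]
      · right
        have hu : H = Finset.univ := by
          rw [← Finset.card_eq_iff_eq_univ, Fintype.card_fin, hcard]; omega
        subst hu
        simp
    · intro h hh x hx
      obtain ⟨i, hi, rfl⟩ := Multiset.mem_map.1 hh
      rcases hx with hx | hx <;>
      · obtain ⟨j, hj, rfl⟩ := Multiset.mem_map.1 hx
        rw [Finset.mem_val, Finset.mem_filter] at hj
        exact htop i hi j hj.2.1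
  · rintro ⟨H, hcard, -, hH⟩
    refine strat_wins c R P k (fun i => decide (i ∈ H)) ?_ ?_
    · simp [hcard]
    · intro g hwin
      refine hH (fun i => if g i = c then a else g i) ?_ ?_
      · intro i _
        rcases hall (g i) with h | h | h <;> simp [h, hac, hbc]
      · rw [vetoWinner_iff] at hwin ⊢
        intro y
        by_cases hy : y = c
        · rw [hy]
        have := hwin y
        simp only [vW_append_ofFn, decide_eq_true_eq] at this ⊢
        refine le_trans (le_trans ?_ this) ?_ <;> gcongr with i
        · by_cases hi : i ∈ H
          · simp [hi]
          · by_cases hg : g i = c <;> simp [hi, hg, hac]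
        · by_cases hi : i ∈ H
          · simp [hi]
          · by_cases hg : g i = c
            · simp [hi, hg, Ne.symm hy]
            · simp [hi, hg]
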